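/- Let 𝒜 be a countably infinite linearly ordered set with no greatest and no least element. Then the set 𝒮 of external addresses over 𝒜, equipped with the lexicographic order, is order-isomorphic to ℝ. Consequently, the set 𝒮̃ := 𝒮 ∪ {−∞, +∞} (with −∞ < s < +∞ for all s ∈ 𝒮), equipped with the order topology, is homeomorphic to the interval [0,1], and the subset 𝒜^{ℕ₀} of infinite external addresses is dense in 𝒮̃. -/

import Mathlib

open Set Filter Topology Metric

/-- A straight brush in the sense of Aarts–Oversteegen: a closed subset of
`[0,∞) × (ℝ ∖ ℚ)` such that every point lies on a hair `[t_y,∞) × {y}`, the set of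
base points of hairs is dense in the irrationals, and every point is approximated by
hairs from above and below whose endpoints converge to the endpoint of its own hair. -/
def IsStraightBrush (B : Set (ℝ × ℝ)) : Prop :=
  IsClosed B ∧
  B ⊆ {p : ℝ × ℝ | 0 ≤ p.1 ∧ Irrational p.2} ∧
  (∀ p ∈ B, ∃ t : ℝ, 0 ≤ t ∧ {x : ℝ | (x, p.2) ∈ B} = Set.Ici t) ∧
  (∀ y : ℝ, Irrational y → ∀ ε > 0, ∃ y' x : ℝ, |y' - y| < ε ∧ (x, y') ∈ B) ∧
  (∀ p ∈ B, ∀ t : ℝ, {x : ℝ | (x, p.2) ∈ B} = Set.Ici t →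
    ∃ β γ tβ tγ : ℕ → ℝ,
      (∀ n, β n < p.2 ∧ p.2 < γ n ∧
        {x : ℝ | (x, β n) ∈ B} = Set.Ici (tβ n) ∧
        {x : ℝ | (x, γ n) ∈ B} = Set.Ici (tγ n)) ∧
      Tendsto β atTop (nhds p.2) ∧ Tendsto γ atTop (nhds p.2) ∧
      Tendsto tβ atTop (nhds t) ∧ Tendsto tγ atTop (nhds t))

/-- A Cantor bouquet: a subset of the plane (`ℂ` identified with `ℝ²`) which is
ambiently homeomorphic to a straight brush. -/
def IsCantorBouquet (X : Set ℂ) : Prop :=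
  ∃ h : (ℝ × ℝ) ≃ₜ (ℝ × ℝ), IsStraightBrush (h '' ((⇑Complex.equivRealProd) '' X))

section AddressDefs

/-- An intermediate entry ("Dedekind cut") of a linearly ordered alphabet `α`,
represented by its lower part `A⁻` (with `A⁺ = (A⁻)ᶜ`). -/
abbrev ACut (α : Type*) [LinearOrder α] : Type _ :=
  {A : Set α // A.Nonempty ∧ Aᶜ.Nonempty ∧ IsLowerSet A}

/-- The extended alphabet `Ā`: elements of `α` together with intermediate entries. -/
abbrev ExtEntry (α : Type*) [LinearOrder α] : Type _ := α ⊕ ACut α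

/-- The linear order on the extended alphabet. -/
def ExtEntry.lt {α : Type*} [LinearOrder α] : ExtEntry α → ExtEntry α → Prop
  | Sum.inl a, Sum.inl b => a < b
  | Sum.inl a, Sum.inr c => a ∈ c.1
  | Sum.inr c, Sum.inl a => a ∉ c.1
  | Sum.inr c, Sum.inr c' => c.1 ⊂ c'.1

/-- An external address over the alphabet `α`: either an infinite sequence of letters,
or a finite sequence of letters followed by an intermediate entry. -/
inductive Address (α : Type*) [LinearOrder α] : Type _ where
  | inf : (ℕ → α) → Address α
  | inter : (n : ℕ) → (Fin n → α) → ACut α → Address α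

/-- The `j`-th entry of an address, as an element of the extended alphabet
(`none` beyond the end of an intermediate address). -/
def Address.entry {α : Type*} [LinearOrder α] : Address α → ℕ → Option (ExtEntry α)
  | Address.inf s, j => some (Sum.inl (s j))
  | Address.inter n T c, j =>
      if h : j < n then some (Sum.inl (T ⟨j, h⟩))
      else if j = n then some (Sum.inr c) else none

/-- The lexicographic order on addresses: compare at the first differing index. -/
def Address.lt {α : Type*} [LinearOrder α] (s t : Address α) : Prop :=
  ∃ k : ℕ, (∀ j < k, s.entry j = t.entry j) ∧
    ∃ a b : ExtEntry α, s.entry k = some a ∧ t.entry k = some b ∧ ExtEntry.lt a b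

end AddressDefs

section AddressOrder

variable {α : Type*} [LinearOrder α]

namespace ExtEntry

theorem lt_irrefl : ∀ a : ExtEntry α, ¬ ExtEntry.lt a a
  | Sum.inl a, h => _root_.lt_irrefl a h
  | Sum.inr c, h => (ssubset_irrefl c.1 : ¬ c.1 ⊂ c.1) h

theorem lt_trans : ∀ {a b c : ExtEntry α}, ExtEntry.lt a b → ExtEntry.lt b c → ExtEntry.lt a c
  | Sum.inl _, Sum.inl _, Sum.inl _, h, h' => _root_.lt_trans (α := α) h h'
  | Sum.inl _, Sum.inl _, Sum.inr c, h, h' => c.2.2.2 (le_of_lt (α := α) h) h'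
  | Sum.inl a, Sum.inr c, Sum.inl b, h, h' => by
      by_contra hab
      exact h' (c.2.2.2 (not_lt.1 hab) h)
  | Sum.inl _, Sum.inr c, Sum.inr d, h, h' => (show c.1 ⊂ d.1 from h').1 h
  | Sum.inr c, Sum.inl _, Sum.inl _, h, h' => fun hc => h (c.2.2.2 (le_of_lt (α := α) h') hc)
  | Sum.inr c, Sum.inl b, Sum.inr d, h, h' => by
      refine show c.1 ⊂ d.1 from ⟨fun x hx => ?_, fun hdc => h (hdc h')⟩
      refine d.2.2.2 (le_of_not_ge fun hbx => h (c.2.2.2 hbx hx)) h'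
  | Sum.inr c, Sum.inr d, Sum.inl _, h, h' => fun hc => h' ((show c.1 ⊂ d.1 from h).1 hc)
  | Sum.inr c, Sum.inr d, Sum.inr e, h, h' =>
      ssubset_trans (show c.1 ⊂ d.1 from h) (show d.1 ⊂ e.1 from h')

theorem lt_or_lt_of_ne : ∀ {a b : ExtEntry α}, a ≠ b → ExtEntry.lt a b ∨ ExtEntry.lt b a
  | Sum.inl _, Sum.inl _, h => lt_or_gt_of_ne fun hab => h (congrArg _ hab)
  | Sum.inl a, Sum.inr c, _ => em (a ∈ c.1)
  | Sum.inr c, Sum.inl a, _ => (em (a ∈ c.1)).symm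
  | Sum.inr c, Sum.inr d, h => by
      have hne : c.1 ≠ d.1 := fun hcd => h (congrArg _ (Subtype.ext hcd))
      rcases c.2.2.2.total d.2.2.2 with hcd | hcd
      · exact Or.inl (hcd.ssubset_of_ne hne)
      · exact Or.inr (hcd.ssubset_of_ne hne.symm)

theorem exists_letter_gt [NoMaxOrder α] : ∀ a : ExtEntry α, ∃ y : α, ExtEntry.lt a (Sum.inl y)
  | Sum.inl a => exists_gt a
  | Sum.inr c => c.2.2.1

theorem exists_letter_lt [NoMinOrder α] : ∀ a : ExtEntry α, ∃ y : α, ExtEntry.lt (Sum.inl y) a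
  | Sum.inl a => exists_lt a
  | Sum.inr c => c.2.1

end ExtEntry

namespace Address

theorem entry_eq_none_iff (s : Address α) (k : ℕ) :
    s.entry k = none ↔ ∃ j < k, ∃ c, s.entry j = some (Sum.inr c) := by
  cases s with
  | inf u => simp [entry]
  | inter n T c =>
    constructor
    · intro h
      refine ⟨n, ?_, c, by simp [entry]⟩
      by_contra hk
      rcases (not_lt.1 hk).lt_or_eq with hk | hk <;> simp [entry, hk] at h
    · rintro ⟨j, hj, d, hd⟩
      have hjn : j = n := by
        by_contra hne
        rcases lt_or_gt_of_ne hne with hn | hn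
        · simp [entry, hn] at hd
        · simp [entry, hn.not_gt, hn.ne'] at hd
      subst hjn
      simp [entry, hj.not_gt, hj.ne']

theorem exists_entry_inl_of_lt {s : Address α} {j k : ℕ} (hjk : j < k) {a : ExtEntry α}
    (h : s.entry k = some a) : ∃ x, s.entry j = some (Sum.inl x) := by
  rcases hj : s.entry j with _ | x | c
  · obtain ⟨i, hi, c, hc⟩ := (entry_eq_none_iff s j).1 hj
    simp [(entry_eq_none_iff s k).2 ⟨i, hi.trans hjk, c, hc⟩] at h
  · exact ⟨x, rfl⟩
  · simp [(entry_eq_none_iff s k).2 ⟨j, hjk, c, hj⟩] at h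

theorem entry_injective : Function.Injective (entry : Address α → ℕ → Option (ExtEntry α)) := by
  have key : ∀ (u : ℕ → α) n T c, (inf u).entry ≠ (inter n T c).entry := fun u n T c h => by
    have := congrFun h n
    simp [entry] at this
  intro s t h
  cases s with
  | inf u =>
    cases t with
    | inf v => exact congrArg _ (funext fun n => by simpa [entry] using congrFun h n)
    | inter n T c => exact absurd h (key _ _ _ _)
  | inter n T c =>
    cases t with
    | inf v => exact absurd h.symm (key _ _ _ _)
    | inter m R d =>
      have hnm : n = m := by
        rcases lt_trichotomy n m with hlt | heq | hlt
        · simpa [entry, hlt] using congrFun h n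
        · exact heq
        · simpa [entry, hlt] using congrFun h m
      subst hnm
      have hc : c = d := by simpa [entry] using congrFun h n
      have hT : T = R := funext fun i => by simpa [entry] using congrFun h i
      rw [hc, hT]

theorem lt_or_lt_of_ne {s t : Address α} (h : s ≠ t) : Address.lt s t ∨ Address.lt t s := by
  classical
  have hex : ∃ k, s.entry k ≠ t.entry k := by
    by_contra! hall
    exact h (entry_injective (funext hall))
  have hk := Nat.find_spec hex
  have hmin : ∀ j < Nat.find hex, s.entry j = t.entry j := fun j hj =>
    not_not.1 (Nat.find_min hex hj)
  generalize Nat.find hex = k at hk hmin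
  have hnone : s.entry k = none ↔ t.entry k = none := by
    rw [entry_eq_none_iff, entry_eq_none_iff]
    refine exists_congr fun j => and_congr_right fun hj => ?_
    rw [hmin j hj]
  rcases ha : s.entry k with _ | a
  · exact absurd (ha.trans (hnone.1 ha).symm) hk
  rcases hb : t.entry k with _ | b
  · exact absurd ((hnone.2 hb).trans hb.symm) hk
  have hab : a ≠ b := fun hab => hk (by rw [ha, hb, hab])
  exact (ExtEntry.lt_or_lt_of_ne hab).imp (fun hlt => ⟨k, hmin, a, b, ha, hb, hlt⟩)
    fun hlt => ⟨k, fun j hj => (hmin j hj).symm, b, a, hb, ha, hlt⟩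

theorem lt_irrefl (s : Address α) : ¬ Address.lt s s := by
  rintro ⟨k, -, a, b, ha, hb, hab⟩
  obtain rfl : a = b := Option.some_injective _ (ha.symm.trans hb)
  exact ExtEntry.lt_irrefl a hab

theorem lt_trans {s t r : Address α} (h : Address.lt s t) (h' : Address.lt t r) :
    Address.lt s r := by
  obtain ⟨k, hk, a, b, ha, hb, hab⟩ := h
  obtain ⟨l, hl, c, d, hc, hd, hcd⟩ := h'
  rcases lt_trichotomy k l with hkl | rfl | hkl
  · exact ⟨k, fun j hj => (hk j hj).trans (hl j (hj.trans hkl)), a, b, ha,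
      (hl k hkl).symm.trans hb, hab⟩
  · obtain rfl : b = c := Option.some_injective _ (hb.symm.trans hc)
    exact ⟨k, fun j hj => (hk j hj).trans (hl j hj), a, d, ha, hd, ExtEntry.lt_trans hab hcd⟩
  · exact ⟨l, fun j hj => (hk j (hj.trans hkl)).trans (hl j hj), c, d,
      (hk l hkl).trans hc, hd, hcd⟩

noncomputable instance : LinearOrder (Address α) :=
  letI : IsStrictTotalOrder (Address α) Address.lt :=
    { irrefl := lt_irrefl
      trans := fun _ _ _ => lt_trans
      trichotomous := fun s t hst hts => by
        by_contra hne
        exact (lt_or_lt_of_ne hne).elim hst hts }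
  letI := Classical.decRel (Address.lt (α := α))
  linearOrderOfSTO Address.lt

/-- The address `s` begins with the first `k` letters of `p`. -/
def HasPrefix (p : ℕ → α) (k : ℕ) (s : Address α) : Prop :=
  ∀ j < k, s.entry j = some (Sum.inl (p j))

theorem HasPrefix.mono {p : ℕ → α} {k l : ℕ} {s : Address α} (h : HasPrefix p l s) (hkl : k ≤ l) :
    HasPrefix p k s := fun j hj => h j (hj.trans_le hkl)

theorem hasPrefix_zero (p : ℕ → α) (s : Address α) : HasPrefix p 0 s := fun _ hj => by omega

theorem hasPrefix_congr {p q : ℕ → α} {k : ℕ} {s : Address α} (h : ∀ j < k, p j = q j) :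
    HasPrefix p k s ↔ HasPrefix q k s :=
  forall₂_congr fun j hj => by rw [h j hj]

theorem hasPrefix_update_succ {p : ℕ → α} {k : ℕ} {a : α} {s : Address α} :
    HasPrefix (Function.update p k a) (k + 1) s ↔
      HasPrefix p k s ∧ s.entry k = some (Sum.inl a) := by
  constructor
  · refine fun h => ⟨fun j hj => ?_, ?_⟩
    · simpa [hj.ne] using h j (by omega)
    · simpa using h k (by omega)
  · rintro ⟨h, hk⟩ j hj
    rcases Nat.lt_succ_iff_lt_or_eq.1 hj with hj | rfl
    · simpa [hj.ne] using h j hj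
    · simpa using hk

theorem HasPrefix.exists_entry {p : ℕ → α} {k : ℕ} {s : Address α} (h : HasPrefix p k s) :
    ∃ a, s.entry k = some a := by
  refine Option.ne_none_iff_exists'.1 fun hn => ?_
  obtain ⟨j, hj, c, hc⟩ := (entry_eq_none_iff s k).1 hn
  simp [h j hj] at hc

theorem exists_hasPrefix [Nonempty α] {s : Address α} {k : ℕ} {a : ExtEntry α}
    (h : s.entry k = some a) : ∃ p, HasPrefix p k s := by
  have : ∀ j, ∃ x, j < k → s.entry j = some (Sum.inl x) := fun j => by
    by_cases hj : j < k
    · exact (exists_entry_inl_of_lt hj h).imp fun x hx _ => hx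
    · exact ⟨Classical.arbitrary α, fun h => absurd h hj⟩
  choose p hp using this
  exact ⟨p, hp⟩

theorem HasPrefix.lt {p : ℕ → α} {k : ℕ} {s t : Address α} (hs : HasPrefix p k s)
    (ht : HasPrefix p k t) {a b : ExtEntry α} (ha : s.entry k = some a) (hb : t.entry k = some b)
    (hab : ExtEntry.lt a b) : s < t :=
  ⟨k, fun j hj => (hs j hj).trans (ht j hj).symm, a, b, ha, hb, hab⟩

/-- The infinite address whose first `k` letters are those of `p`, followed by `y` forever. -/
def eventuallyConst (p : ℕ → α) (k : ℕ) (y : α) : Address α :=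
  inf fun j => if j < k then p j else y

theorem hasPrefix_eventuallyConst (p : ℕ → α) (k : ℕ) (y : α) :
    HasPrefix p k (eventuallyConst p k y) := fun j hj => by simp [eventuallyConst, entry, hj]

theorem entry_eventuallyConst (p : ℕ → α) (k : ℕ) (y : α) :
    (eventuallyConst p k y).entry k = some (Sum.inl y) := by simp [eventuallyConst, entry]

/-- The eventually constant infinite addresses. -/
def eventuallyConstSet (α : Type*) [LinearOrder α] : Set (Address α) :=
  {s | ∃ p k y, s = eventuallyConst p k y}

theorem countable_eventuallyConstSet [Countable α] : (eventuallyConstSet α).Countable := by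
  refine (countable_range fun q : List α × α => inf fun j => q.1.getD j q.2).mono ?_
  rintro _ ⟨p, k, y, rfl⟩
  refine ⟨((List.range k).map p, y), congrArg inf (funext fun j => ?_)⟩
  by_cases hj : j < k <;> simp [List.getD, hj]

theorem HasPrefix.exists_gt [NoMaxOrder α] {p : ℕ → α} {k : ℕ} {s : Address α}
    (h : HasPrefix p k s) : ∃ t ∈ eventuallyConstSet α, HasPrefix p k t ∧ s < t := by
  obtain ⟨a, ha⟩ := h.exists_entry
  obtain ⟨y, hy⟩ := ExtEntry.exists_letter_gt a
  have hp := hasPrefix_eventuallyConst p k y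
  exact ⟨_, ⟨p, k, y, rfl⟩, hp, h.lt hp ha (entry_eventuallyConst p k y) hy⟩

theorem HasPrefix.exists_lt [NoMinOrder α] {p : ℕ → α} {k : ℕ} {s : Address α}
    (h : HasPrefix p k s) : ∃ t ∈ eventuallyConstSet α, HasPrefix p k t ∧ t < s := by
  obtain ⟨a, ha⟩ := h.exists_entry
  obtain ⟨y, hy⟩ := ExtEntry.exists_letter_lt a
  have hp := hasPrefix_eventuallyConst p k y
  exact ⟨_, ⟨p, k, y, rfl⟩, hp, hp.lt h (entry_eventuallyConst p k y) ha hy⟩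

theorem exists_eventuallyConst_between [Nonempty α] [NoMaxOrder α] [NoMinOrder α]
    {s t : Address α} (hst : s < t) : ∃ r ∈ eventuallyConstSet α, s < r ∧ r < t := by
  obtain ⟨k, hk, a, b, ha, hb, hab⟩ := hst
  obtain ⟨p, hs⟩ := exists_hasPrefix ha
  have ht : HasPrefix p k t := fun j hj => (hk j hj).symm.trans (hs j hj)
  rcases a with a | c
  · obtain ⟨r, hr, hpr, hsr⟩ := (hasPrefix_update_succ.2 ⟨hs, ha⟩).exists_gt
    obtain ⟨hpr, hrk⟩ := hasPrefix_update_succ.1 hpr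
    exact ⟨r, hr, hsr, hpr.lt ht hrk hb hab⟩
  rcases b with b | d
  · obtain ⟨r, hr, hpr, hrt⟩ := (hasPrefix_update_succ.2 ⟨ht, hb⟩).exists_lt
    obtain ⟨hpr, hrk⟩ := hasPrefix_update_succ.1 hpr
    exact ⟨r, hr, hs.lt hpr ha hrk hab, hrt⟩
  · obtain ⟨x, hxd, hxc⟩ := exists_of_ssubset (show c.1 ⊂ d.1 from hab)
    have hp := hasPrefix_eventuallyConst p k x
    have hx := entry_eventuallyConst p k x
    exact ⟨_, ⟨p, k, x, rfl⟩, hs.lt hp ha hx hxc, hp.lt ht hx hb hxd⟩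

theorem HasPrefix.lt_of_lt {p : ℕ → α} {k : ℕ} {s t r : Address α} (hs : HasPrefix p k s)
    (hr : HasPrefix p k r) (ht : ¬ HasPrefix p k t) (h : t < s) : t < r := by
  obtain ⟨i, hi, a, b, ha, hb, hab⟩ := h
  have hik : i < k := by
    by_contra! hki
    exact ht fun j hj => (hi j (hj.trans_le hki)).trans (hs j hj)
  have hsr : ∀ j < k, s.entry j = r.entry j := fun j hj => (hs j hj).trans (hr j hj).symm
  exact ⟨i, fun j hj => (hi j hj).trans (hsr j (hj.trans hik)), a, b, ha,
    (hsr i hik).symm.trans hb, hab⟩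

theorem HasPrefix.gt_of_gt {p : ℕ → α} {k : ℕ} {s t r : Address α} (hs : HasPrefix p k s)
    (hr : HasPrefix p k r) (ht : ¬ HasPrefix p k t) (h : s < t) : r < t := by
  rcases lt_trichotomy r t with hrt | rfl | hrt
  · exact hrt
  · exact absurd hr ht
  · exact absurd (hr.lt_of_lt hs ht hrt) h.not_gt

theorem hasPrefix_inter (p : ℕ → α) (k : ℕ) (c : ACut α) :
    HasPrefix p k (inter k (fun i => p i) c) := fun j hj => by simp [entry, hj]

theorem entry_inter_self (k : ℕ) (T : Fin k → α) (c : ACut α) :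
    (inter k T c).entry k = some (Sum.inr c) := by simp [entry]

theorem HasPrefix.eq_of_entry_inr {p : ℕ → α} {k : ℕ} {s t : Address α} (hs : HasPrefix p k s)
    (ht : HasPrefix p k t) {c : ACut α} (hsc : s.entry k = some (Sum.inr c))
    (htc : t.entry k = some (Sum.inr c)) : s = t := by
  refine entry_injective (funext fun i => ?_)
  rcases lt_trichotomy i k with hik | rfl | hik
  · exact (hs i hik).trans (ht i hik).symm
  · exact hsc.trans htc.symm
  · exact ((entry_eq_none_iff s i).2 ⟨k, hik, c, hsc⟩).trans
      ((entry_eq_none_iff t i).2 ⟨k, hik, c, htc⟩).symm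

theorem HasPrefix.entry_lt_of_lt {p : ℕ → α} {k : ℕ} {s t : Address α} (hs : HasPrefix p k s)
    (ht : HasPrefix p k t) {a b : ExtEntry α} (ha : s.entry k = some a) (hb : t.entry k = some b)
    (hst : s < t) (hab : a ≠ b) : ExtEntry.lt a b :=
  (ExtEntry.lt_or_lt_of_ne hab).resolve_right fun hba => (ht.lt hs hb ha hba).not_gt hst

theorem exists_cut_point_of_forall_prefix {L : Set (Address α)} (hL : IsLowerSet L) (u : ℕ → α)
    (hu : ∀ k, (∃ s ∈ L, HasPrefix u k s) ∧ ∃ s ∉ L, HasPrefix u k s) :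
    ∃ s : Address α, (∀ t < s, t ∈ L) ∧ ∀ t, s < t → t ∉ L := by
  refine ⟨inf u, ?_, ?_⟩
  · rintro t ⟨i, hi, a, b, ha, hb, hab⟩
    obtain ⟨r, hrL, hr⟩ := (hu (i + 1)).1
    have hrb : r.entry i = some b := (hr i i.lt_succ_self).trans hb
    exact hL (le_of_lt (HasPrefix.lt (p := u) hi (hr.mono i.le_succ) ha hrb hab)) hrL
  · rintro t ⟨i, hi, a, b, ha, hb, hab⟩ htL
    obtain ⟨r, hrL, hr⟩ := (hu (i + 1)).2
    have hra : r.entry i = some a := (hr i i.lt_succ_self).trans ha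
    have ht : HasPrefix u i t := fun j hj => (hi j hj).symm
    exact hrL (hL (le_of_lt ((hr.mono i.le_succ).lt ht hra hb hab)) htL)

theorem exists_cut_point_of_prefix [NoMaxOrder α] [NoMinOrder α] {L : Set (Address α)}
    (hL : IsLowerSet L) (p : ℕ → α) (k : ℕ) (hin : ∃ s ∈ L, HasPrefix p k s)
    (hout : ∃ s ∉ L, HasPrefix p k s)
    (hp : ∀ a, ¬ ((∃ s ∈ L, HasPrefix (Function.update p k a) (k + 1) s) ∧
      ∃ s ∉ L, HasPrefix (Function.update p k a) (k + 1) s)) :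
    ∃ s : Address α, (∀ t < s, t ∈ L) ∧ ∀ t, s < t → t ∉ L := by
  obtain ⟨s₁, hs₁L, hs₁⟩ := hin
  obtain ⟨s₂, hs₂L, hs₂⟩ := hout
  let A : Set α := {a | eventuallyConst p k a ∈ L}
  have hprefix := hasPrefix_eventuallyConst p k
  have hentry := entry_eventuallyConst p k
  have hmem : ∀ a ∈ A, ∀ s, HasPrefix p k s → s.entry k = some (Sum.inl a) → s ∈ L := by
    intro a ha s hs hsa
    by_contra hsL
    exact hp a ⟨⟨_, ha, hasPrefix_update_succ.2 ⟨hprefix a, hentry a⟩⟩,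
      s, hsL, hasPrefix_update_succ.2 ⟨hs, hsa⟩⟩
  have hnotMem : ∀ a ∉ A, ∀ s, HasPrefix p k s → s.entry k = some (Sum.inl a) → s ∉ L := by
    intro a ha s hs hsa hsL
    exact hp a ⟨⟨s, hsL, hasPrefix_update_succ.2 ⟨hs, hsa⟩⟩,
      _, ha, hasPrefix_update_succ.2 ⟨hprefix a, hentry a⟩⟩
  have hlow : IsLowerSet A := by
    intro a b hba ha
    rcases hba.eq_or_lt with rfl | hba
    · exact ha
    · exact hL (le_of_lt ((hprefix b).lt (hprefix a) (hentry b) (hentry a) hba)) ha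
  have hne : A.Nonempty := by
    obtain ⟨a, ha⟩ := hs₁.exists_entry
    obtain ⟨y, hy⟩ := ExtEntry.exists_letter_lt a
    exact ⟨y, hL (le_of_lt ((hprefix y).lt hs₁ (hentry y) ha hy)) hs₁L⟩
  have hne' : Aᶜ.Nonempty := by
    obtain ⟨a, ha⟩ := hs₂.exists_entry
    obtain ⟨y, hy⟩ := ExtEntry.exists_letter_gt a
    exact ⟨y, fun hyL => hs₂L (hL (le_of_lt (hs₂.lt (hprefix y) ha (hentry y) hy)) hyL)⟩
  let c : ACut α := ⟨A, hne, hne', hlow⟩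
  have hs := hasPrefix_inter p k c
  have hsc := entry_inter_self k (fun i => p i) c
  refine ⟨inter k (fun i => p i) c, fun t hts => ?_, fun t hst htL => ?_⟩
  · by_cases ht : HasPrefix p k t
    · obtain ⟨x, hx⟩ := ht.exists_entry
      have hxc : x ≠ Sum.inr c := by
        rintro rfl
        exact hts.ne (ht.eq_of_entry_inr hs hx hsc)
      have hlt := ht.entry_lt_of_lt hs hx hsc hts hxc
      rcases x with x | d
      · exact hmem x hlt t ht hx
      · obtain ⟨y, hyA, hyd⟩ := exists_of_ssubset (show d.1 ⊂ A from hlt)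
        exact hL (le_of_lt (ht.lt (hprefix y) hx (hentry y) hyd)) hyA
    · exact hL (le_of_lt (hs.lt_of_lt hs₁ ht hts)) hs₁L
  · by_cases ht : HasPrefix p k t
    · obtain ⟨x, hx⟩ := ht.exists_entry
      have hxc : Sum.inr c ≠ x := by
        rintro rfl
        exact hst.ne (hs.eq_of_entry_inr ht hsc hx)
      have hlt := hs.entry_lt_of_lt ht hsc hx hst hxc
      rcases x with x | d
      · exact hnotMem x hlt t ht hx htL
      · obtain ⟨y, hyd, hyA⟩ := exists_of_ssubset (show A ⊂ d.1 from hlt)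
        exact hyA (hL (le_of_lt ((hprefix y).lt ht (hentry y) hx hyd)) htL)
    · exact hs₂L (hL (le_of_lt (hs.gt_of_gt hs₂ ht hst)) htL)

/-- Every Dedekind cut in the space of addresses is filled. -/
theorem exists_cut_point [Nonempty α] [NoMaxOrder α] [NoMinOrder α] {L : Set (Address α)}
    (hL : IsLowerSet L) (hne : L.Nonempty) (hne' : Lᶜ.Nonempty) :
    ∃ s : Address α, (∀ t < s, t ∈ L) ∧ ∀ t, s < t → t ∉ L := by
  let Split (p : ℕ → α) (k : ℕ) : Prop :=
    (∃ s ∈ L, HasPrefix p k s) ∧ ∃ s ∉ L, HasPrefix p k s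
  by_cases h : ∃ p k, Split p k ∧ ∀ a, ¬ Split (Function.update p k a) (k + 1)
  · obtain ⟨p, k, hpk, hp⟩ := h
    exact exists_cut_point_of_prefix hL p k hpk.1 hpk.2 hp
  push Not at h
  choose! F hF using h
  let f : ℕ → ℕ → α := Nat.rec (fun _ => Classical.arbitrary α)
    fun k p => Function.update p k (F p k)
  have hf : ∀ k, f (k + 1) = Function.update (f k) k (F (f k) k) := fun k => rfl
  have hsplit : ∀ k, Split (f k) k := by
    intro k
    induction k with
    | zero => exact ⟨hne.imp fun s hs => ⟨hs, hasPrefix_zero _ s⟩,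
        hne'.imp fun s hs => ⟨hs, hasPrefix_zero _ s⟩⟩
    | succ k ih => exact hF _ _ ih
  have hstable : ∀ k, ∀ j < k, f k j = f (j + 1) j := by
    intro k
    induction k with
    | zero => intro j hj; omega
    | succ k ih =>
      intro j hj
      rcases Nat.lt_succ_iff_lt_or_eq.1 hj with hj | rfl
      · rw [hf k, Function.update_of_ne hj.ne, ih j hj]
      · rfl
  refine exists_cut_point_of_forall_prefix hL (fun j => f (j + 1) j) fun k => ?_
  have hcongr := fun s : Address α => hasPrefix_congr (s := s) (hstable k)
  simpa only [Split, hcongr] using hsplit k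

end Address

end AddressOrder

/-- A linear order without endpoints in which every Dedekind cut is filled and which has a
countable order-dense subset is order-isomorphic to `ℝ`. -/
theorem nonempty_orderIso_real_of_countable_dense {X : Type*} [LinearOrder X] [Nonempty X]
    [NoMaxOrder X] [NoMinOrder X] {D : Set X} (hD : D.Countable)
    (hdense : ∀ x y, x < y → ∃ d ∈ D, x < d ∧ d < y)
    (hcut : ∀ L : Set X, IsLowerSet L → L.Nonempty → Lᶜ.Nonempty →
      ∃ s, (∀ t < s, t ∈ L) ∧ ∀ t, s < t → t ∉ L) :
    Nonempty (X ≃o ℝ) := by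
  have hlt : ∀ x : X, ∃ d : D, (d : X) < x := fun x => by
    obtain ⟨y, hy⟩ := exists_lt x
    obtain ⟨d, hd, -, hdx⟩ := hdense y x hy
    exact ⟨⟨d, hd⟩, hdx⟩
  have hgt : ∀ x : X, ∃ d : D, x < (d : X) := fun x => by
    obtain ⟨y, hy⟩ := exists_gt x
    obtain ⟨d, hd, hdx, -⟩ := hdense x y hy
    exact ⟨⟨d, hd⟩, hdx⟩
  have : Countable D := hD.to_subtype
  have : Nonempty D := (hlt (Classical.arbitrary X)).nonempty
  have : NoMaxOrder D := ⟨fun d => hgt d⟩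
  have : NoMinOrder D := ⟨fun d => hlt d⟩
  have : DenselyOrdered D := ⟨fun a b hab => by
    obtain ⟨d, hd, had, hdb⟩ := hdense a b hab
    exact ⟨⟨d, hd⟩, had, hdb⟩⟩
  obtain ⟨φ⟩ := Order.iso_of_countable_dense D ℚ
  let S (x : X) : Set ℝ := {r | ∃ d : D, (d : X) < x ∧ ((φ d : ℚ) : ℝ) = r}
  have hSne : ∀ x, (S x).Nonempty := fun x => (hlt x).elim fun d hd => ⟨_, d, hd, rfl⟩
  have hSle : ∀ (x : X) (b : D), x ≤ b → ∀ r ∈ S x, r ≤ ((φ b : ℚ) : ℝ) := by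
    rintro x b hb _ ⟨d, hd, rfl⟩
    exact Rat.cast_le.2 (φ.monotone (show (d : X) ≤ b from hd.le.trans hb))
  have hSbdd : ∀ x, BddAbove (S x) := fun x =>
    (hgt x).elim fun b hb => ⟨_, hSle x b hb.le⟩
  let e : X → ℝ := fun x => sSup (S x)
  have hle_e : ∀ (x : X) (d : D), (d : X) < x → ((φ d : ℚ) : ℝ) ≤ e x := fun x d hd =>
    le_csSup (hSbdd x) ⟨d, hd, rfl⟩
  have he_le : ∀ (x : X) (d : D), x ≤ d → e x ≤ ((φ d : ℚ) : ℝ) := fun x d hd =>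
    csSup_le (hSne x) (hSle x d hd)
  have hmono : StrictMono e := by
    intro x y hxy
    obtain ⟨c, hc, hxc, hcy⟩ := hdense x y hxy
    obtain ⟨d, hd, hcd, hdy⟩ := hdense c y hcy
    calc e x ≤ ((φ ⟨c, hc⟩ : ℚ) : ℝ) := he_le x ⟨c, hc⟩ hxc.le
      _ < ((φ ⟨d, hd⟩ : ℚ) : ℝ) := Rat.cast_lt.2 (φ.strictMono hcd)
      _ ≤ e y := hle_e y ⟨d, hd⟩ hdy
  have hsurj : Function.Surjective e := by
    intro r
    obtain ⟨q₁, hq₁⟩ := exists_rat_lt r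
    obtain ⟨q₂, hq₂⟩ := exists_rat_gt r
    let L : Set X := {x | ∃ d : D, x ≤ d ∧ ((φ d : ℚ) : ℝ) < r}
    have hmemL : ∀ d : D, (d : X) ∈ L ↔ ((φ d : ℚ) : ℝ) < r := by
      refine fun d => ⟨?_, fun h => ⟨d, le_rfl, h⟩⟩
      rintro ⟨b, hdb, hb⟩
      exact (Rat.cast_le.2 (φ.monotone (show d ≤ b from hdb))).trans_lt hb
    obtain ⟨s, hs, hs'⟩ := hcut L (fun x y hyx ⟨d, hd, hdr⟩ => ⟨d, hyx.trans hd, hdr⟩)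
      ⟨φ.symm q₁, (hmemL _).2 (by simpa using hq₁)⟩
      ⟨φ.symm q₂, fun h => hq₂.not_gt (by simpa using (hmemL _).1 h)⟩
    refine ⟨s, le_antisymm (csSup_le (hSne s) ?_) (le_of_not_gt fun hlt => ?_)⟩
    · rintro _ ⟨d, hd, rfl⟩
      exact ((hmemL d).1 (hs d hd)).le
    · obtain ⟨q, hsq, hqr⟩ := exists_rat_btwn hlt
      obtain ⟨q', hsq', hqq'⟩ := exists_rat_btwn hsq
      have hq : ((φ.symm q : D) : X) ∈ L := (hmemL _).2 (by simpa using hqr)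
      have hqs : ((φ.symm q : D) : X) ≤ s := le_of_not_gt fun h => hs' _ h hq
      have hq's : ((φ.symm q' : D) : X) < s :=
        lt_of_lt_of_le (φ.symm.strictMono (Rat.cast_lt.1 hqq')) hqs
      exact hsq'.not_ge (by simpa using hle_e s _ hq's)
  exact ⟨hmono.orderIsoOfSurjective e hsurj⟩

/-- For a countably infinite linearly ordered alphabet `α` with no
greatest and no least element, the space `𝒮` of external addresses, in the
lexicographic order, is order-isomorphic to `ℝ`; under such an isomorphism the set of
infinite external addresses has dense image (hence `𝒮̃ = 𝒮 ∪ {±∞}`, carrying the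
order topology transported to `[-∞,∞] ≅ [0,1]`, is homeomorphic to `[0,1]` with
`α^{ℕ₀}` dense in it). -/
theorem address_space_order_iso_real (α : Type) [LinearOrder α] [Countable α]
    [Infinite α] [NoMaxOrder α] [NoMinOrder α] :
    ∃ e : Address α → ℝ,
      Function.Surjective e ∧
      (∀ s t : Address α, Address.lt s t ↔ e s < e t) ∧
      Dense (e '' {s : Address α | ∃ u : ℕ → α, s = Address.inf u}) := by
  have : Nonempty (Address α) := ⟨Address.inf fun _ => Classical.arbitrary α⟩
  have hpre := Address.hasPrefix_zero fun _ : ℕ => Classical.arbitrary α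
  have : NoMaxOrder (Address α) :=
    ⟨fun s => (hpre s).exists_gt.imp fun _ ht => ht.2.2⟩
  have : NoMinOrder (Address α) :=
    ⟨fun s => (hpre s).exists_lt.imp fun _ ht => ht.2.2⟩
  obtain ⟨e⟩ := nonempty_orderIso_real_of_countable_dense
    (Address.countable_eventuallyConstSet (α := α))
    (fun _ _ => Address.exists_eventuallyConst_between) fun _ => Address.exists_cut_point
  refine ⟨e, e.surjective, fun s t => e.lt_iff_lt.symm, dense_of_exists_between fun x y hxy => ?_⟩
  obtain ⟨_, ⟨p, k, y, rfl⟩, hxr, hry⟩ :=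
    Address.exists_eventuallyConst_between (e.symm.lt_iff_lt.2 hxy)
  exact ⟨_, ⟨_, ⟨_, rfl⟩, rfl⟩, e.symm_apply_lt.1 hxr, e.lt_symm_apply.1 hry⟩
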